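/- arXiv:2407.18508 — 5 statements merged into one kernel-verified Lean document; each statement's English description precedes it below -/
import Mathlib

section
/- Let the dispersion be ω(k) = |k|² on ℝ³. If 𝒮 ⊆ ℝ³ has non-empty interior, then the collisional region satisfies Coll[𝒮] = ℝ³ \ {0}. -/
open Set

open Set

/-- One step of the collision process: points reachable from `S` by one resonant
4-wave interaction (with the origin removed). -/
def collStep (ω : EuclideanSpace ℝ (Fin 3) → ℝ) (S : Set (EuclideanSpace ℝ (Fin 3))) :
    Set (EuclideanSpace ℝ (Fin 3)) :=
  {k | ∃ k₁ ∈ S, ∃ k₂ ∈ S, ∃ k₃ ∈ S,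
      k = k₁ + k₂ - k₃ ∧ ω k = ω k₁ + ω k₂ - ω k₃ ∧ k₁ + k₂ ≠ 0} \ {0}

/-- The iterated collision sets `𝒮ₙ[𝒮]`. -/
def collSet (ω : EuclideanSpace ℝ (Fin 3) → ℝ) (S : Set (EuclideanSpace ℝ (Fin 3))) :
    ℕ → Set (EuclideanSpace ℝ (Fin 3))
  | 0 => S \ {0}
  | n + 1 => collStep ω (collSet ω S n)

/-- The collisional region `Coll[𝒮] = ⋃ₙ 𝒮ₙ[𝒮]`. -/
def Coll (ω : EuclideanSpace ℝ (Fin 3) → ℝ) (S : Set (EuclideanSpace ℝ (Fin 3))) :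
    Set (EuclideanSpace ℝ (Fin 3)) :=
  ⋃ n : ℕ, collSet ω S n

/-- In three dimensions, any two vectors admit a common orthogonal vector of prescribed norm. -/
lemma exists_orthogonal_pair_norm_eq (x y : EuclideanSpace ℝ (Fin 3)) {l : ℝ} (hl : 0 ≤ l) :
    ∃ w : EuclideanSpace ℝ (Fin 3), inner ℝ x w = 0 ∧ inner ℝ y w = 0 ∧ ‖w‖ = l := by
  classical
  have hspan :
      Module.finrank ℝ (Submodule.span ℝ ({x, y} : Set (EuclideanSpace ℝ (Fin 3)))) ≤ 2 := by
    have h := finrank_span_finset_le_card (R := ℝ) ({x, y} : Finset (EuclideanSpace ℝ (Fin 3)))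
    rw [Finset.coe_pair] at h
    exact h.trans Finset.card_le_two
  have hsum := (Submodule.span ℝ
    ({x, y} : Set (EuclideanSpace ℝ (Fin 3)))).finrank_add_finrank_orthogonal
  rw [finrank_euclideanSpace_fin] at hsum
  have hne : (Submodule.span ℝ ({x, y} : Set (EuclideanSpace ℝ (Fin 3))))ᗮ ≠ ⊥ := by
    intro h
    rw [h, finrank_bot] at hsum
    omega
  obtain ⟨v, hv, hv0⟩ := Submodule.exists_mem_ne_zero_of_ne_bot hne
  rw [Submodule.mem_orthogonal] at hv
  have hx := hv x (Submodule.subset_span (by simp))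
  have hy := hv y (Submodule.subset_span (by simp))
  have hn : ‖v‖ ≠ 0 := norm_ne_zero_iff.mpr hv0
  refine ⟨(l / ‖v‖) • v, ?_, ?_, ?_⟩
  · rw [inner_smul_right, hx, mul_zero]
  · rw [inner_smul_right, hy, mul_zero]
  · rw [norm_smul, Real.norm_eq_abs, abs_of_nonneg (by positivity), div_mul_cancel₀ _ hn]

/-- The fourth vertex of a rectangle with three vertices in `S` is reached in one collision
for the quadratic dispersion. -/
lemma mem_collStep_of_inner_eq_zero {S : Set (EuclideanSpace ℝ (Fin 3))}
    {k a b : EuclideanSpace ℝ (Fin 3)} (hk : k ≠ 0) (hab : inner ℝ a b = 0)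
    (h₁ : k - a ∈ S) (h₂ : k - b ∈ S) (h₃ : k - a - b ∈ S) (hsum : k - a + (k - b) ≠ 0) :
    k ∈ collStep (fun k => ‖k‖ ^ 2) S := by
  refine ⟨⟨k - a, h₁, k - b, h₂, k - a - b, h₃, by abel, ?_, hsum⟩, hk⟩
  have e₁ := norm_sub_sq_real k b
  have e₂ := norm_sub_sq_real (k - a) b
  rw [inner_sub_left, hab] at e₂
  simp only
  linarith

lemma zero_notMem_collSet (ω : EuclideanSpace ℝ (Fin 3) → ℝ)
    (S : Set (EuclideanSpace ℝ (Fin 3))) (n : ℕ) : 0 ∉ collSet ω S n := by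
  cases n <;> exact fun h => h.2 rfl

/-- A vector orthogonal to `u` can only be cancelled by `u` when both vanish. -/
lemma eq_zero_of_add_eq_zero_of_inner_eq_zero {u w : EuclideanSpace ℝ (Fin 3)}
    (huw : inner ℝ u w = 0) (h : u + w = 0) : w = 0 := by
  rw [eq_neg_of_add_eq_zero_left h, inner_neg_left, neg_eq_zero] at huw
  exact inner_self_eq_zero.mp huw

/-- If `S` contains the ball of radius `r` about `c ≠ 0`, then the `n`-th collision set contains
the ball of radius `√2 ^ n * r` about `c`, except possibly the points `0` and `-c`. -/
lemma mem_collSet_of_norm_sub_sq_lt {S : Set (EuclideanSpace ℝ (Fin 3))}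
    {c : EuclideanSpace ℝ (Fin 3)} {r : ℝ} (hc : c ≠ 0) (hr : 0 < r)
    (hS : Metric.ball c r ⊆ S) (n : ℕ) :
    ∀ k : EuclideanSpace ℝ (Fin 3), k ≠ 0 → k ≠ -c → ‖k - c‖ ^ 2 < 2 ^ n * r ^ 2 →
      k ∈ collSet (fun k => ‖k‖ ^ 2) S n := by
  have : IsAddTorsionFree (EuclideanSpace ℝ (Fin 3)) := .of_module_rat _
  have hcc : c ≠ -c := fun h => hc (self_eq_neg.mp h)
  induction n with
  | zero =>
    intro k hk _ hlt
    refine ⟨hS ?_, hk⟩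
    rw [mem_ball_iff_norm]
    rw [pow_zero, one_mul] at hlt
    exact lt_of_pow_lt_pow_left₀ 2 hr.le hlt
  | succ n ih =>
    intro k hk hkc hlt
    have hcmem : c ∈ collSet (fun k => ‖k‖ ^ 2) S n :=
      ih c hc hcc (by rw [sub_self, norm_zero, zero_pow two_ne_zero]; positivity)
    by_cases hkc' : k = c
    · subst hkc'
      refine mem_collStep_of_inner_eq_zero (a := 0) (b := 0) hk (inner_zero_left _) ?_ ?_ ?_ ?_
      · simpa using hcmem
      · simpa using hcmem
      · simpa using hcmem
      · simpa [← two_smul ℝ] using hk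
    · obtain ⟨w, hkw, hcw, hw⟩ := exists_orthogonal_pair_norm_eq k c
        (l := ‖k - c‖ / 2) (by positivity)
      have hw0 : w ≠ 0 := by
        rw [← norm_ne_zero_iff, hw]
        exact div_ne_zero (norm_ne_zero_iff.mpr (sub_ne_zero.mpr hkc')) two_ne_zero
      have key : ∀ v : EuclideanSpace ℝ (Fin 3), inner ℝ k v = 0 → inner ℝ c v = 0 →
          ‖v‖ = ‖k - c‖ / 2 → v ≠ 0 →
          k - ((1 / 2 : ℝ) • (k - c) - v) ∈ collSet (fun k => ‖k‖ ^ 2) S n := by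
        intro v hkv hcv hv hv0
        apply ih
        · intro h
          refine hv0 (eq_zero_of_add_eq_zero_of_inner_eq_zero
            (u := k - (1 / 2 : ℝ) • (k - c)) ?_ ?_)
          · simp [inner_sub_left, inner_smul_left, hkv, hcv]
          · rw [← h]; abel
        · intro h
          refine hv0 (eq_zero_of_add_eq_zero_of_inner_eq_zero
            (u := k - (1 / 2 : ℝ) • (k - c) + c) ?_ ?_)
          · simp [inner_sub_left, inner_add_left, inner_smul_left, hkv, hcv]
          · rw [← add_eq_zero_iff_eq_neg] at h
            rw [← h]; abel
        · have e : k - ((1 / 2 : ℝ) • (k - c) - v) - c = (1 / 2 : ℝ) • (k - c) + v := by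
            module
          have ho : inner ℝ ((1 / 2 : ℝ) • (k - c)) v = 0 := by
            simp [inner_sub_left, inner_smul_left, hkv, hcv]
          rw [e, norm_add_sq_real, ho, hv, norm_smul, Real.norm_eq_abs,
            abs_of_pos (by norm_num : (0 : ℝ) < 1 / 2)]
          rw [pow_succ (2 : ℝ)] at hlt
          nlinarith
      refine mem_collStep_of_inner_eq_zero (a := (1 / 2 : ℝ) • (k - c) - w)
        (b := (1 / 2 : ℝ) • (k - c) - -w) hk ?_ (key w hkw hcw hw hw0)
        (key (-w) (by simpa using hkw) (by simpa using hcw) (by simpa using hw)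
          (neg_ne_zero.mpr hw0)) ?_ ?_
      · rw [sub_neg_eq_add, inner_sub_left, inner_add_right, inner_add_right,
          real_inner_comm _ w, real_inner_self_eq_norm_sq, real_inner_self_eq_norm_sq, hw,
          norm_smul, Real.norm_eq_abs, abs_of_pos (by norm_num : (0 : ℝ) < 1 / 2)]
        ring
      · convert hcmem using 1
        module
      · intro h
        apply hkc
        rw [← add_eq_zero_iff_eq_neg, ← h]
        module

/-- For the dispersion `ω(k) = |k|²` on ℝ³, if `𝒮` has non-empty
interior then the collisional region is all of `ℝ³ \ {0}`. -/
theorem coll_region_quadratic (S : Set (EuclideanSpace ℝ (Fin 3)))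
    (hS : (interior S).Nonempty) :
    Coll (fun k => ‖k‖ ^ 2) S = {(0 : EuclideanSpace ℝ (Fin 3))}ᶜ := by
  obtain ⟨c, hc, hc0⟩ : ∃ c ∈ interior S, c ≠ 0 := by
    obtain ⟨c, hc, hc0⟩ := (dense_compl_singleton
      (0 : EuclideanSpace ℝ (Fin 3))).inter_open_nonempty _ isOpen_interior hS
    exact ⟨c, hc, hc0⟩
  obtain ⟨r, hr, hball⟩ := Metric.isOpen_iff.mp isOpen_interior c hc
  have hmem := mem_collSet_of_norm_sub_sq_lt hc0 hr (hball.trans interior_subset)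
  have hlarge : ∀ R : ℝ, ∃ n : ℕ, R < 2 ^ n * r ^ 2 := fun R => by
    obtain ⟨n, hn⟩ := pow_unbounded_of_one_lt (R / r ^ 2) (one_lt_two (α := ℝ))
    exact ⟨n, (div_lt_iff₀ (by positivity)).mp hn⟩
  ext k
  simp only [Coll, mem_iUnion, mem_compl_iff, mem_singleton_iff]
  refine ⟨fun ⟨n, hn⟩ h => zero_notMem_collSet _ S n (h ▸ hn), fun hk => ?_⟩
  by_cases hkc : k = -c
  · obtain ⟨a, hka, -, ha⟩ := exists_orthogonal_pair_norm_eq k k zero_le_one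
    obtain ⟨b, hkb, hab, hb⟩ := exists_orthogonal_pair_norm_eq k a zero_le_one
    have ha0 : a ≠ 0 := norm_ne_zero_iff.mp (by rw [ha]; exact one_ne_zero)
    have hb0 : b ≠ 0 := norm_ne_zero_iff.mp (by rw [hb]; exact one_ne_zero)
    have hne : ∀ v, inner ℝ k v = 0 → k - v ≠ 0 := fun v hv h => by
      rw [← sub_eq_zero.mp h] at hv
      exact hk (inner_self_eq_zero.mp hv)
    have hab0 : a + b ≠ 0 := fun h => hb0 (eq_zero_of_add_eq_zero_of_inner_eq_zero hab h)
    have hkab : inner ℝ k (a + b) = 0 := by rw [inner_add_right, hka, hkb, add_zero]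
    obtain ⟨n, hn⟩ := hlarge (‖k - a - c‖ ^ 2 + ‖k - b - c‖ ^ 2 + ‖k - (a + b) - c‖ ^ 2)
    have p₁ := sq_nonneg ‖k - a - c‖
    have p₂ := sq_nonneg ‖k - b - c‖
    have p₃ := sq_nonneg ‖k - (a + b) - c‖
    refine ⟨n + 1, mem_collStep_of_inner_eq_zero (a := a) (b := b) hk hab ?_ ?_ ?_ ?_⟩
    · exact hmem n _ (hne a hka) (by rw [← hkc]; simpa using ha0) (by linarith)
    · exact hmem n _ (hne b hkb) (by rw [← hkc]; simpa using hb0) (by linarith)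
    · rw [sub_sub]
      exact hmem n _ (hne _ hkab) (by rw [← hkc]; simpa using hab0) (by linarith)
    · intro h
      refine hne ((1 / 2 : ℝ) • (a + b)) (by rw [inner_smul_right, hkab, mul_zero]) ?_
      have e : k - (1 / 2 : ℝ) • (a + b) = (1 / 2 : ℝ) • (k - a + (k - b)) := by module
      rw [e, h, smul_zero]
  · obtain ⟨n, hn⟩ := hlarge (‖k - c‖ ^ 2)
    exact ⟨n, hmem n k hk hkc hn⟩
end

section
/- Under the dispersion assumptions, let g be a global weak solution of the reduced 4-wave kinetic equation with radial initial datum f₀ ≥ 0 (i.e. g(0,ω) = ℧(r(ω)) r(ω) f₀(r(ω))) whose support satisfies: either (I) Ω(ρ) = ρ² and the support of f₀ has non-empty interior in ℝ³, or (II) the origin belongs to the interior of the support of f₀. Then for every k ∈ ℝ³ there exists a time T₀ > 0 such that k belongs to the support of f(T₀, ·), the radial density at time T₀; equivalently, for every ω* > 0 there exists T₀ > 0 such that ω* belongs to the support of g(T₀, ·). -/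
open MeasureTheory Set Filter

/-- Dispersion assumptions on the profile `Ω` of the dispersion relation
`ω(k) = Ω(|k|)`, together with its inverse `r = Ω⁻¹` and the auxiliary
function `℧(ρ) = ρ / Ω'(ρ)` (named `U` here). -/
structure Dispersion where
  Ω : ℝ → ℝ
  Ω_zero : Ω 0 = 0
  Ω_smooth : ContDiffOn ℝ 1 Ω (Set.Ici 0)
  Ω_strictMono : StrictMonoOn Ω (Set.Ici 0)
  Ω_convex : ConvexOn ℝ (Set.Ici 0) Ω
  Ω_bij : Set.BijOn Ω (Set.Ici 0) (Set.Ici 0)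
  r : ℝ → ℝ
  r_nonneg : ∀ x, 0 ≤ x → 0 ≤ r x
  r_left : ∀ ρ, 0 ≤ ρ → r (Ω ρ) = ρ
  r_right : ∀ x, 0 ≤ x → Ω (r x) = x
  U : ℝ → ℝ
  U_def : ∀ ρ, 0 < ρ → U ρ = ρ / derivWithin Ω (Set.Ici 0) ρ
  U_mono : MonotoneOn U (Set.Ioi 0)
  CU : ℝ
  iota : ℝ
  CU_nonneg : 0 ≤ CU
  iota_nonneg : 0 ≤ iota
  iota_le_one : iota ≤ 1
  U_bound : ∀ ρ, 0 < ρ → U ρ ≤ CU * ρ ^ iota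
  α : ℝ
  α' : ℝ
  Cω : ℝ
  Cω' : ℝ
  α_gt_one : 1 < α
  α_le_two : α ≤ 2
  α'_gt_one : 1 < α'
  α'_le_α : α' ≤ α
  Cω_pos : 0 < Cω
  Cω'_pos : 0 < Cω'
  Ω_lower : ∀ ρ, 0 ≤ ρ → Cω * ρ ^ α ≤ Ω ρ
  Ω_upper : ∀ ρ, 0 ≤ ρ → ρ < 1 → Ω ρ ≤ Cω' * ρ ^ α'

/-- The collision kernel `𝒦(ω,ω₁,ω₂)` of the reduced 4-wave kinetic equation. -/
noncomputable def kernel (D : Dispersion) (ω ω₁ ω₂ : ℝ) : ℝ :=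
  D.U (D.r (ω + ω₁ - ω₂)) *
    min (min (D.r ω) (D.r ω₁)) (min (D.r ω₂) (D.r (ω + ω₁ - ω₂))) /
      (D.r ω * D.r ω₁ * D.r ω₂)

/-- `g : [0,∞) → L¹((0,∞))` is `C¹`: there is a time derivative `dg`, integrable in `ω`,
which is the derivative of `g` in the `L¹` sense, and which depends `L¹`-continuously
on time. -/
def C1inL1 (g : ℝ → ℝ → ℝ) : Prop :=
  ∃ dg : ℝ → ℝ → ℝ,
    (∀ t, 0 ≤ t → MeasureTheory.IntegrableOn (dg t) (Set.Ioi 0)) ∧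
    (∀ t, 0 ≤ t → Filter.Tendsto
      (fun h : ℝ => ∫ ω in Set.Ioi (0:ℝ), |g (t + h) ω - g t ω - h * dg t ω| / |h|)
      (nhdsWithin 0 {(0:ℝ)}ᶜ) (nhds 0)) ∧
    (∀ t, 0 ≤ t → Filter.Tendsto
      (fun s : ℝ => ∫ ω in Set.Ioi (0:ℝ), |dg s ω - dg t ω|) (nhds t) (nhds 0))

/-- A nonnegative `g ∈ C¹([0,∞); L¹((0,∞)))` is a global weak solution of the reduced
4-wave kinetic equation with collision constant `CQ` if the weak formulation holds for
every `C²` compactly supported test function. -/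
def IsWeakSolution (D : Dispersion) (CQ : ℝ) (g : ℝ → ℝ → ℝ) : Prop :=
  (∀ t, 0 ≤ t → ∀ ω, 0 < ω → 0 ≤ g t ω) ∧
  (∀ t, 0 ≤ t → MeasureTheory.IntegrableOn (g t) (Set.Ioi 0)) ∧
  C1inL1 g ∧
  ∀ φ : ℝ → ℝ, ContDiff ℝ 2 φ → HasCompactSupport φ → ∀ t, 0 ≤ t →
    (∫ ω in Set.Ioi (0:ℝ), g t ω * φ ω) - (∫ ω in Set.Ioi (0:ℝ), g 0 ω * φ ω) =
      CQ * ∫ s in (0:ℝ)..t, ∫ ω in Set.Ioi (0:ℝ), ∫ ω₁ in Set.Ioi (0:ℝ),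
        ∫ ω₂ in Set.Ioi (0:ℝ),
          g s ω * g s ω₁ * g s ω₂ * kernel D ω ω₁ ω₂ *
            (φ ω₂ + φ (ω + ω₁ - ω₂) - φ ω - φ ω₁) *
            (if ω₂ ≤ ω + ω₁ then (1:ℝ) else 0)

namespace Dispersion

variable (D : Dispersion)

lemma Ω_nonneg {ρ : ℝ} (h : 0 ≤ ρ) : 0 ≤ D.Ω ρ := D.Ω_bij.mapsTo h

lemma r_pos {x : ℝ} (hx : 0 < x) : 0 < D.r x := by
  refine lt_of_le_of_ne (D.r_nonneg x hx.le) fun h => hx.ne ?_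
  rw [← D.r_right x hx.le, ← h, D.Ω_zero]

lemma r_zero : D.r 0 = 0 := by
  simpa [D.Ω_zero] using D.r_left 0 le_rfl

lemma le_r_of_Ω_le {ρ x : ℝ} (hρ : 0 ≤ ρ) (hx : 0 ≤ x) (h : D.Ω ρ ≤ x) : ρ ≤ D.r x :=
  (D.Ω_strictMono.le_iff_le hρ (D.r_nonneg x hx)).1 (by rwa [D.r_right x hx])

lemma r_le_of_le_Ω {ρ x : ℝ} (hρ : 0 ≤ ρ) (hx : 0 ≤ x) (h : x ≤ D.Ω ρ) : D.r x ≤ ρ :=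
  (D.Ω_strictMono.le_iff_le (D.r_nonneg x hx) hρ).1 (by rwa [D.r_right x hx])

lemma r_mono {x y : ℝ} (hx : 0 ≤ x) (hxy : x ≤ y) : D.r x ≤ D.r y :=
  D.r_le_of_le_Ω (D.r_nonneg y (hx.trans hxy)) hx (by rwa [D.r_right y (hx.trans hxy)])

/-- A convex profile vanishing at the origin is star-shaped. -/
lemma Ω_mul_le {t ρ : ℝ} (ht : 0 ≤ t) (ht1 : t ≤ 1) (hρ : 0 ≤ ρ) :
    D.Ω (t * ρ) ≤ t * D.Ω ρ := by
  have h := D.Ω_convex.2 (show ρ ∈ Ici (0 : ℝ) from hρ) (self_mem_Ici (a := (0 : ℝ)))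
    ht (sub_nonneg.2 ht1) (by ring)
  simpa [D.Ω_zero] using h

lemma r_le_two_mul {x w : ℝ} (hx : 0 ≤ x) (hw : 0 ≤ w) (h : w ≤ 2 * x) :
    D.r w ≤ 2 * D.r x := by
  have hr := D.r_nonneg x hx
  refine D.r_le_of_le_Ω (by positivity) hw ?_
  have h2 := D.Ω_mul_le (t := 1 / 2) (by norm_num) (by norm_num)
    (show 0 ≤ 2 * D.r x by positivity)
  rw [show 1 / 2 * (2 * D.r x) = D.r x by ring, D.r_right x hx] at h2
  linarith

lemma mul_le_r {δ m : ℝ} (hδ : 0 < δ) (hm : 0 ≤ m) (h : m ≤ δ) :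
    D.r δ / δ * m ≤ D.r m := by
  have hr := D.r_nonneg δ hδ.le
  refine D.le_r_of_Ω_le (by positivity) hm ?_
  have h2 := D.Ω_mul_le (t := m / δ) (by positivity) ((div_le_one hδ).2 h) hr
  rw [D.r_right δ hδ.le, div_mul_cancel₀ _ hδ.ne'] at h2
  rwa [show D.r δ / δ * m = m / δ * D.r δ by ring]

lemma U_pos {ρ : ℝ} (hρ : 0 < ρ) : 0 < D.U ρ := by
  have hd : DifferentiableWithinAt ℝ D.Ω (Ici 0) ρ :=
    D.Ω_smooth.differentiableOn (by norm_num) ρ hρ.le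
  have h := D.Ω_convex.slope_le_derivWithin (x := 0) (y := ρ) self_mem_Ici hρ.le hρ hd
  have hΩ : 0 < D.Ω ρ := by
    simpa [D.Ω_zero] using D.Ω_strictMono self_mem_Ici hρ.le hρ
  rw [D.U_def ρ hρ]
  refine div_pos hρ (lt_of_lt_of_le ?_ h)
  rw [slope_def_field, D.Ω_zero]
  positivity

lemma U_le {ρ : ℝ} (hρ : 0 < ρ) : D.U ρ ≤ D.CU * (1 + ρ) := by
  refine (D.U_bound ρ hρ).trans (mul_le_mul_of_nonneg_left ?_ D.CU_nonneg)
  calc ρ ^ D.iota ≤ (1 + ρ) ^ D.iota :=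
        Real.rpow_le_rpow hρ.le (by linarith) D.iota_nonneg
    _ ≤ (1 + ρ) ^ (1 : ℝ) :=
        Real.rpow_le_rpow_of_exponent_le (by linarith) D.iota_le_one
    _ = 1 + ρ := Real.rpow_one _

end Dispersion

lemma kernel_symm (D : Dispersion) (x y z : ℝ) : kernel D x y z = kernel D y x z := by
  unfold kernel
  rw [add_comm y x, min_comm (D.r y), mul_comm (D.r y)]

lemma kernel_eq_zero_of_add_eq (D : Dispersion) {x y z : ℝ} (hx : 0 < x) (hy : 0 < y)
    (hz : 0 < z) (h : x + y - z = 0) : kernel D x y z = 0 := by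
  have h1 : 0 ≤ min (D.r x) (D.r y) := le_min (D.r_nonneg x hx.le) (D.r_nonneg y hy.le)
  simp [kernel, h, D.r_zero, D.r_nonneg z hz.le, h1]

lemma kernel_pos (D : Dispersion) {x y z : ℝ} (hx : 0 < x) (hy : 0 < y)
    (hz : 0 < z) (h : 0 < x + y - z) : 0 < kernel D x y z := by
  have := D.r_pos hx
  have := D.r_pos hy
  have := D.r_pos hz
  have := D.r_pos h
  have := D.U_pos this
  unfold kernel
  positivity

lemma kernel_nonneg (D : Dispersion) {x y z : ℝ} (hx : 0 < x) (hy : 0 < y)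
    (hz : 0 < z) (h : z ≤ x + y) : 0 ≤ kernel D x y z := by
  rcases (sub_nonneg.2 h).eq_or_lt with h0 | h0
  · exact (kernel_eq_zero_of_add_eq D hx hy hz h0.symm).ge
  · exact (kernel_pos D hx hy hz h0).le

/-- Away from the origin in the larger incoming frequency `x`, the kernel is controlled by
the inverse of the larger of the remaining two wave numbers. -/
lemma kernel_le (D : Dispersion) {δ x y z : ℝ} (hδ : 0 < δ) (hx : δ ≤ x) (hy : 0 < y)
    (hz : 0 < z) (hyx : y ≤ x) (h : z ≤ x + y) :
    kernel D x y z ≤ D.CU * (1 / D.r δ + 2) / D.r (max y z) := by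
  have hx0 : 0 < x := hδ.trans_le hx
  have hrδ := D.r_pos hδ
  have hrx := D.r_pos hx0
  have hry := D.r_pos hy
  have hrz := D.r_pos hz
  have hm : 0 < D.r (max y z) := D.r_pos (lt_max_of_lt_left hy)
  have hCU := D.CU_nonneg
  rcases (sub_nonneg.2 h).eq_or_lt with h0 | h0
  · rw [kernel_eq_zero_of_add_eq D hx0 hy hz h0.symm]
    positivity
  have hrw := D.r_pos h0
  have hU : D.U (D.r (x + y - z)) ≤ D.CU * (1 / D.r δ + 2) * D.r x := by
    refine (D.U_le hrw).trans ?_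
    rw [mul_assoc]
    refine mul_le_mul_of_nonneg_left ?_ hCU
    have h1 := D.r_le_two_mul hx0.le h0.le (by linarith : x + y - z ≤ 2 * x)
    have h2 : 1 ≤ 1 / D.r δ * D.r x := by
      rw [one_div, ← div_eq_inv_mul, one_le_div hrδ]
      exact D.r_mono hδ.le hx
    nlinarith
  have hmin : min (min (D.r x) (D.r y)) (min (D.r z) (D.r (x + y - z))) * D.r (max y z)
      ≤ D.r y * D.r z := by
    rcases le_total y z with hyz | hyz
    · rw [max_eq_right hyz]
      exact mul_le_mul_of_nonneg_right ((min_le_left _ _).trans (min_le_right _ _)) hrz.le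
    · rw [max_eq_left hyz, mul_comm (D.r y)]
      exact mul_le_mul_of_nonneg_right ((min_le_right _ _).trans (min_le_left _ _)) hry.le
  unfold kernel
  rw [div_le_div_iff₀ (by positivity) hm]
  calc D.U (D.r (x + y - z)) *
        min (min (D.r x) (D.r y)) (min (D.r z) (D.r (x + y - z))) * D.r (max y z)
      = D.U (D.r (x + y - z)) *
        (min (min (D.r x) (D.r y)) (min (D.r z) (D.r (x + y - z))) * D.r (max y z)) := by ring
    _ ≤ (D.CU * (1 / D.r δ + 2) * D.r x) * (D.r y * D.r z) := by
        refine mul_le_mul hU hmin (by positivity) (by positivity)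
    _ = D.CU * (1 / D.r δ + 2) * (D.r x * D.r y * D.r z) := by ring

/-- The symbol against which `g(ω) g(ω₁) g(ω₂)` is integrated in the weak formulation. -/
noncomputable def symbol (D : Dispersion) (φ : ℝ → ℝ) (p : ℝ × ℝ × ℝ) : ℝ :=
  kernel D p.1 p.2.1 p.2.2 *
    (φ p.2.2 + φ (p.1 + p.2.1 - p.2.2) - φ p.1 - φ p.2.1) *
    (if p.2.2 ≤ p.1 + p.2.1 then (1 : ℝ) else 0)

lemma symbol_symm (D : Dispersion) (φ : ℝ → ℝ) (x y z : ℝ) :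
    symbol D φ (x, y, z) = symbol D φ (y, x, z) := by
  simp only [symbol]
  rw [kernel_symm D x y z, add_comm y x]
  ring

lemma abs_symbol_le_of_le (D : Dispersion) {φ : ℝ → ℝ} {B δ : ℝ} {L : NNReal} (hδ : 0 < δ)
    (hB : ∀ x, |φ x| ≤ B) (hL : LipschitzWith L φ) (h0 : ∀ x ≤ δ, φ x = 0)
    {x y z : ℝ} (hx : 0 < x) (hy : 0 < y) (hz : 0 < z) (hyx : y ≤ x) :
    |symbol D φ (x, y, z)| ≤
      D.CU * (1 / D.r (δ / 2) + 2) * (4 * B / D.r δ + L * (δ / D.r δ)) := by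
  have hB0 : 0 ≤ B := (abs_nonneg _).trans (hB 0)
  have hCU := D.CU_nonneg
  have hrδ := D.r_pos hδ
  have hrδ2 := D.r_pos (half_pos hδ)
  set A := D.CU * (1 / D.r (δ / 2) + 2)
  have hA : 0 ≤ A := by positivity
  have hR : 0 ≤ A * (4 * B / D.r δ + L * (δ / D.r δ)) := by positivity
  simp only [symbol]
  split_ifs with hw
  swap
  · simpa using hR
  rcases le_total x (δ / 2) with hxs | hxs
  · rw [h0 x (by linarith), h0 y (by linarith), h0 z (by linarith), h0 (x + y - z) (by linarith)]
    simpa using hR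
  have hm : 0 < max y z := lt_max_of_lt_left hy
  have hrm := D.r_pos hm
  have hK := kernel_le D (half_pos hδ) hxs hy hz hyx hw
  have hK0 := kernel_nonneg D hx hy hz hw
  rw [mul_one, abs_mul, abs_of_nonneg hK0]
  rcases le_total δ (max y z) with hmδ | hmδ
  · have hφ : |φ z + φ (x + y - z) - φ x - φ y| ≤ 4 * B := by
      have h1 := abs_le.1 (hB x)
      have h2 := abs_le.1 (hB y)
      have h3 := abs_le.1 (hB z)
      have h4 := abs_le.1 (hB (x + y - z))
      rw [abs_le]
      constructor <;> linarith
    calc _ ≤ A / D.r (max y z) * (4 * B) := mul_le_mul hK hφ (abs_nonneg _) (by positivity)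
      _ ≤ A / D.r δ * (4 * B) := by
        gcongr
        exact D.r_mono hδ.le hmδ
      _ = A * (4 * B / D.r δ) := by ring
      _ ≤ _ := by
        gcongr
        exact le_add_of_nonneg_right (by positivity)
  · have hφ : |φ z + φ (x + y - z) - φ x - φ y| ≤ L * max y z := by
      rw [h0 y ((le_max_left _ _).trans hmδ), h0 z ((le_max_right _ _).trans hmδ)]
      have h1 := hL.dist_le_mul (x + y - z) x
      rw [Real.dist_eq, Real.dist_eq] at h1
      rw [zero_add, sub_zero]
      refine h1.trans (mul_le_mul_of_nonneg_left ?_ L.coe_nonneg)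
      rw [show x + y - z - x = y - z by ring, abs_le]
      constructor <;> linarith [le_max_left y z, le_max_right y z]
    have hr := D.mul_le_r hδ hm.le hmδ
    have hmr : max y z / D.r (max y z) ≤ δ / D.r δ := by
      rw [div_le_div_iff₀ hrm hrδ]
      calc max y z * D.r δ = D.r δ / δ * max y z * δ := by field_simp
        _ ≤ D.r (max y z) * δ := by gcongr
        _ = δ * D.r (max y z) := by ring
    calc _ ≤ A / D.r (max y z) * (L * max y z) :=
          mul_le_mul hK hφ (abs_nonneg _) (by positivity)
      _ = A * (L * (max y z / D.r (max y z))) := by ring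
      _ ≤ A * (L * (δ / D.r δ)) := by gcongr
      _ ≤ _ := by
        gcongr
        exact le_add_of_nonneg_left (by positivity)

/-- Cancellation in the collision bracket compensates the low-frequency singularity of the
kernel, so the symbol of a test function vanishing near the origin is bounded. -/
lemma exists_abs_symbol_le (D : Dispersion) {φ : ℝ → ℝ} {δ : ℝ} (hδ : 0 < δ)
    (hφ : ContDiff ℝ 2 φ) (hc : HasCompactSupport φ) (h0 : ∀ x ≤ δ, φ x = 0) :
    ∃ C, ∀ x y z : ℝ, 0 < x → 0 < y → 0 < z → |symbol D φ (x, y, z)| ≤ C := by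
  obtain ⟨B, hB⟩ := hφ.continuous.bounded_above_of_compact_support hc
  obtain ⟨L, hL⟩ := hφ.lipschitzWith_of_hasCompactSupport hc (by norm_num)
  refine ⟨D.CU * (1 / D.r (δ / 2) + 2) * (4 * B / D.r δ + L * (δ / D.r δ)),
    fun x y z hx hy hz => ?_⟩
  rcases le_total y x with h | h
  · exact abs_symbol_le_of_le D hδ hB hL h0 hx hy hz h
  · rw [symbol_symm]
    exact abs_symbol_le_of_le D hδ hB hL h0 hy hx hz h

/-- Lebesgue measure on the frequency half-line. -/
noncomputable abbrev halfLine : Measure ℝ := volume.restrict (Ioi 0)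

/-- The product measure on triples of positive frequencies. -/
noncomputable abbrev octant : Measure (ℝ × ℝ × ℝ) := halfLine.prod (halfLine.prod halfLine)

lemma octant_ae_pos : ∀ᵐ p ∂octant, 0 < p.1 ∧ 0 < p.2.1 ∧ 0 < p.2.2 := by
  have h : octant = (volume.prod (volume.prod volume)).restrict
      (Ioi (0 : ℝ) ×ˢ (Ioi (0 : ℝ) ×ˢ Ioi (0 : ℝ))) := by
    rw [octant, Measure.prod_restrict, Measure.prod_restrict]
  rw [h]
  filter_upwards [ae_restrict_mem (measurableSet_Ioi.prod (measurableSet_Ioi.prod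
    measurableSet_Ioi))] with p hp
  simpa using hp

lemma aestronglyMeasurable_symbol (D : Dispersion) {φ : ℝ → ℝ} (hφ : Measurable φ) :
    AEStronglyMeasurable (symbol D φ) octant := by
  have hr : Measurable fun x => D.r (max x 0) :=
    Monotone.measurable fun x y h => D.r_mono (le_max_right _ _) (max_le_max_right 0 h)
  have hU : Measurable fun x => D.U (Real.exp x) :=
    Monotone.measurable fun x y h =>
      D.U_mono (Real.exp_pos x) (Real.exp_pos y) (Real.exp_le_exp.2 h)
  let R : ℝ → ℝ := fun x => D.r (max x 0)
  let V : ℝ → ℝ := fun ρ => D.U (Real.exp (Real.log ρ))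
  have hR : Measurable R := hr
  have hV : Measurable V := hU.comp Real.measurable_log
  let H : ℝ × ℝ × ℝ → ℝ := fun p =>
    V (R (p.1 + p.2.1 - p.2.2)) *
      min (min (R p.1) (R p.2.1)) (min (R p.2.2) (R (p.1 + p.2.1 - p.2.2))) /
      (R p.1 * R p.2.1 * R p.2.2) *
    (φ p.2.2 + φ (p.1 + p.2.1 - p.2.2) - φ p.1 - φ p.2.1) *
    (if p.2.2 ≤ p.1 + p.2.1 then (1 : ℝ) else 0)
  have hH : Measurable H := by
    have hite : Measurable fun p : ℝ × ℝ × ℝ => if p.2.2 ≤ p.1 + p.2.1 then (1 : ℝ) else 0 :=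
      Measurable.ite (measurableSet_le (by fun_prop) (by fun_prop)) measurable_const
        measurable_const
    fun_prop
  refine ⟨H, hH.stronglyMeasurable, ?_⟩
  filter_upwards [octant_ae_pos] with ⟨x, y, z⟩ ⟨hx, hy, hz⟩
  simp only at hx hy hz
  simp only [symbol, H]
  split_ifs with hw
  swap
  · simp
  have e1 : R x = D.r x := by simp [R, hx.le]
  have e2 : R y = D.r y := by simp [R, hy.le]
  have e3 : R z = D.r z := by simp [R, hz.le]
  have e4 : R (x + y - z) = D.r (x + y - z) := by simp [R, hw]
  rw [e1, e2, e3, e4]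
  rcases (sub_nonneg.2 hw).eq_or_lt with h0 | h0
  · rw [kernel_eq_zero_of_add_eq D hx hy hz h0.symm, ← h0, D.r_zero]
    simp [D.r_nonneg, hx.le, hy.le, hz.le]
  · have e5 : V (D.r (x + y - z)) = D.U (D.r (x + y - z)) := by
      simp only [V]
      rw [Real.exp_log (D.r_pos h0)]
    rw [e5, kernel]

lemma integrable_tripleProd {f₁ f₂ f₃ : ℝ → ℝ} (h₁ : Integrable f₁ halfLine)
    (h₂ : Integrable f₂ halfLine) (h₃ : Integrable f₃ halfLine) :
    Integrable (fun p : ℝ × ℝ × ℝ => f₁ p.1 * (f₂ p.2.1 * f₃ p.2.2)) octant :=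
  h₁.mul_prod (h₂.mul_prod h₃)

lemma integral_tripleProd (f₁ f₂ f₃ : ℝ → ℝ) :
    ∫ p : ℝ × ℝ × ℝ, f₁ p.1 * (f₂ p.2.1 * f₃ p.2.2) ∂octant =
      (∫ x, f₁ x ∂halfLine) * ((∫ x, f₂ x ∂halfLine) * ∫ x, f₃ x ∂halfLine) := by
  rw [← integral_prod_mul f₂ f₃]
  exact integral_prod_mul f₁ (fun q : ℝ × ℝ => f₂ q.1 * f₃ q.2)

/-- The collision operator tested against a symbol `H`. -/
noncomputable def collision (H : ℝ × ℝ × ℝ → ℝ) (f : ℝ → ℝ) : ℝ :=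
  ∫ p : ℝ × ℝ × ℝ, f p.1 * (f p.2.1 * f p.2.2) * H p ∂octant

lemma integrable_collision {H : ℝ × ℝ × ℝ → ℝ} {C : ℝ}
    (hH : AEStronglyMeasurable H octant) (hC : ∀ᵐ p ∂octant, |H p| ≤ C)
    {f : ℝ → ℝ} (hf : Integrable f halfLine) :
    Integrable (fun p : ℝ × ℝ × ℝ => f p.1 * (f p.2.1 * f p.2.2) * H p) octant :=
  (integrable_tripleProd hf hf hf).mul_bdd hH hC

lemma collision_eq_iterated {H : ℝ × ℝ × ℝ → ℝ} {C : ℝ}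
    (hH : AEStronglyMeasurable H octant) (hC : ∀ᵐ p ∂octant, |H p| ≤ C)
    {f : ℝ → ℝ} (hf : Integrable f halfLine) :
    collision H f = ∫ x in Ioi (0 : ℝ), ∫ y in Ioi (0 : ℝ), ∫ z in Ioi (0 : ℝ),
      f x * (f y * f z) * H (x, y, z) := by
  have hi := integrable_collision hH hC hf
  rw [collision, integral_prod _ hi]
  refine integral_congr_ae ?_
  filter_upwards [hi.prod_right_ae] with x hx
  exact integral_prod _ hx

lemma abs_collision_sub_le {H : ℝ × ℝ × ℝ → ℝ} {C : ℝ}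
    (hH : AEStronglyMeasurable H octant) (hC : ∀ᵐ p ∂octant, |H p| ≤ C)
    {f g : ℝ → ℝ} (hf : Integrable f halfLine)
    (hg : Integrable g halfLine) :
    |collision H f - collision H g| ≤
      C * ((∫ x, |f x - g x| ∂halfLine) * ((∫ x, |f x| ∂halfLine) * ∫ x, |f x| ∂halfLine) +
        ((∫ x, |g x| ∂halfLine) * ((∫ x, |f x - g x| ∂halfLine) * ∫ x, |f x| ∂halfLine) +
        (∫ x, |g x| ∂halfLine) * ((∫ x, |g x| ∂halfLine) * ∫ x, |f x - g x| ∂halfLine))) := by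
  have hd := (hf.sub hg).abs
  simp only [Pi.sub_apply] at hd
  have i1 := integrable_tripleProd hd hf.abs hf.abs
  have i2 := integrable_tripleProd hg.abs hd hf.abs
  have i3 := integrable_tripleProd hg.abs hg.abs hd
  have i23 : Integrable (fun p : ℝ × ℝ × ℝ => |g p.1| * (|f p.2.1 - g p.2.1| * |f p.2.2|) +
      |g p.1| * (|g p.2.1| * |f p.2.2 - g p.2.2|)) octant := i2.add i3
  rw [collision, collision,
    ← integral_sub (integrable_collision hH hC hf) (integrable_collision hH hC hg),
    ← integral_tripleProd, ← integral_tripleProd, ← integral_tripleProd,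
    ← integral_add i2 i3, ← integral_add i1 i23, ← integral_const_mul,
    ← Real.norm_eq_abs]
  refine norm_integral_le_of_norm_le ((i1.add i23).const_mul C) ?_
  filter_upwards [hC] with p hp
  have e : f p.1 * (f p.2.1 * f p.2.2) * H p - g p.1 * (g p.2.1 * g p.2.2) * H p =
      ((f p.1 - g p.1) * (f p.2.1 * f p.2.2) + (g p.1 * ((f p.2.1 - g p.2.1) * f p.2.2) +
        g p.1 * (g p.2.1 * (f p.2.2 - g p.2.2)))) * H p := by ring
  rw [e, Real.norm_eq_abs, abs_mul, mul_comm]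
  refine mul_le_mul hp ?_ (abs_nonneg _) ((abs_nonneg _).trans hp)
  refine (abs_add_le _ _).trans ?_
  refine add_le_add (by simp only [abs_mul, le_refl]) ?_
  refine (abs_add_le _ _).trans ?_
  simp only [abs_mul, le_refl]

lemma tendsto_collision {H : ℝ × ℝ × ℝ → ℝ} {C : ℝ}
    (hH : AEStronglyMeasurable H octant) (hC : ∀ᵐ p ∂octant, |H p| ≤ C)
    {l : Filter ℝ} {f : ℝ → ℝ → ℝ} {g : ℝ → ℝ}
    (hf : ∀ᶠ s in l, Integrable (f s) halfLine) (hg : Integrable g halfLine)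
    (h : Tendsto (fun s => ∫ x, |f s x - g x| ∂halfLine) l (nhds 0)) :
    Tendsto (fun s => collision H (f s)) l (nhds (collision H g)) := by
  rw [tendsto_iff_dist_tendsto_zero]
  have hn : Tendsto (fun s => ∫ x, |f s x| ∂halfLine) l (nhds (∫ x, |g x| ∂halfLine)) := by
    rw [tendsto_iff_dist_tendsto_zero]
    refine squeeze_zero' (Eventually.of_forall fun _ => dist_nonneg) ?_ h
    filter_upwards [hf] with s hs
    rw [Real.dist_eq, ← integral_sub hs.abs hg.abs, ← Real.norm_eq_abs]
    have hd : Integrable (fun x => |f s x - g x|) halfLine := (hs.sub hg).abs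
    exact norm_integral_le_of_norm_le hd
      (Eventually.of_forall fun x => abs_abs_sub_abs_le_abs_sub (f s x) (g x))
  have hlim := ((h.mul (hn.mul hn)).add (((tendsto_const_nhds (x := ∫ x, |g x| ∂halfLine)).mul
    (h.mul hn)).add ((tendsto_const_nhds (x := ∫ x, |g x| ∂halfLine)).mul
    ((tendsto_const_nhds (x := ∫ x, |g x| ∂halfLine)).mul h)))).const_mul C
  simp only [zero_mul, mul_zero, add_zero] at hlim
  refine squeeze_zero' (Eventually.of_forall fun _ => dist_nonneg) ?_ hlim
  filter_upwards [hf] with s hs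
  exact abs_collision_sub_le hH hC hs hg

/-- A `C¹` curve in `L¹` is continuous in `L¹` on `[0,∞)`. -/
lemma C1inL1.tendsto_integral_abs_sub {g : ℝ → ℝ → ℝ} (hg : C1inL1 g)
    (hi : ∀ t, 0 ≤ t → IntegrableOn (g t) (Ioi 0)) {t : ℝ} (ht : 0 ≤ t) :
    Tendsto (fun s => ∫ x, |g s x - g t x| ∂halfLine) (nhdsWithin t (Ici 0)) (nhds 0) := by
  obtain ⟨dg, hdi, hd, -⟩ := hg
  have hsub : Tendsto (fun s => s - t) (nhds t) (nhds 0) := by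
    simpa using (tendsto_id (α := ℝ) (x := nhds t)).sub_const t
  have hE : Tendsto (fun s => ∫ x in Ioi (0 : ℝ),
      |g (t + (s - t)) x - g t x - (s - t) * dg t x| / |s - t|)
      (nhdsWithin t {t}ᶜ) (nhds 0) := by
    refine (hd t ht).comp (tendsto_nhdsWithin_iff.2 ⟨hsub.mono_left nhdsWithin_le_nhds, ?_⟩)
    filter_upwards [self_mem_nhdsWithin] with s hs
    simpa [sub_eq_zero] using hs
  have hA : Tendsto (fun s => |s - t|) (nhds t) (nhds 0) := by simpa using hsub.abs
  have hlim := (hA.mono_left (nhdsWithin_le_nhds (s := {t}ᶜ))).mul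
    (hE.add_const (∫ x in Ioi (0 : ℝ), |dg t x|))
  rw [zero_mul] at hlim
  have hpunct : Tendsto (fun s => ∫ x, |g s x - g t x| ∂halfLine)
      (nhdsWithin t ({t}ᶜ ∩ Ici 0)) (nhds 0) := by
    refine squeeze_zero' (Eventually.of_forall fun s => integral_nonneg fun x => abs_nonneg _) ?_
      (hlim.mono_left (nhdsWithin_mono t inter_subset_left))
    filter_upwards [self_mem_nhdsWithin] with s hs
    have hst : 0 < |s - t| := abs_pos.2 (sub_ne_zero.2 hs.1)
    have hrem : Integrable (fun x => g s x - g t x - (s - t) * dg t x) halfLine :=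
      ((hi s hs.2).sub (hi t ht)).sub ((hdi t ht).const_mul _)
    rw [add_sub_cancel, ← integral_add (hrem.abs.div_const _) (hdi t ht).abs,
      ← integral_const_mul]
    refine integral_mono ((hi s hs.2).sub (hi t ht)).abs
      (((hrem.abs.div_const _).add (hdi t ht).abs).const_mul _) fun x => ?_
    simp only
    rw [mul_add, mul_div_cancel₀ _ hst.ne', ← abs_mul]
    simpa using abs_add_le (g s x - g t x - (s - t) * dg t x) ((s - t) * dg t x)
  have hpt : Tendsto (fun s => ∫ x, |g s x - g t x| ∂halfLine) (pure t) (nhds 0) := by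
    rw [tendsto_pure_left]
    intro s hs
    simpa using mem_of_mem_nhds hs
  refine (hpunct.sup hpt).mono_left ?_
  rw [← nhdsWithin_singleton, ← nhdsWithin_union]
  refine nhdsWithin_mono t fun s hs => ?_
  by_cases h : s = t
  · exact Or.inr h
  · exact Or.inl ⟨h, hs⟩

/-- Restriction of Lebesgue measure to the positive frequencies where `G` does not vanish. -/
noncomputable abbrev carrier (G : ℝ → ℝ) : Measure ℝ := halfLine.restrict (Function.support G)

lemma carrier_pos_inter {G : ℝ → ℝ} {x : ℝ} (hx : x ∈ (carrier G).support) {V : Set ℝ}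
    (hV : IsOpen V) (hxV : x ∈ V) : 0 < halfLine (V ∩ Function.support G) := by
  rw [← Measure.restrict_apply hV.measurableSet]
  exact (Measure.mem_support_iff_forall x).1 hx V (hV.mem_nhds hxV)

section WeakSolution

variable {D : Dispersion} {CQ : ℝ} {g : ℝ → ℝ → ℝ}

/-- At a positive time, the collision integral of a nonnegative test function whose mass
vanishes is zero, since the mass attains its minimum there. -/
lemma IsWeakSolution.collision_eq_zero (hg : IsWeakSolution D CQ g) (hCQ : 0 < CQ)
    {φ : ℝ → ℝ} {δ T : ℝ} (hδ : 0 < δ) (hφ : ContDiff ℝ 2 φ) (hc : HasCompactSupport φ)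
    (h0 : ∀ x ≤ δ, φ x = 0) (hφ0 : ∀ x, 0 ≤ φ x) (hT : 0 < T)
    (hmass : ∫ x in Ioi (0 : ℝ), g T x * φ x = 0) :
    collision (symbol D φ) (g T) = 0 := by
  obtain ⟨hpos, hint, hC1, hweak⟩ := hg
  have hH := aestronglyMeasurable_symbol D hφ.continuous.measurable
  obtain ⟨C, hC'⟩ := exists_abs_symbol_le D hδ hφ hc h0
  have hC : ∀ᵐ p ∂octant, |symbol D φ p| ≤ C := by
    filter_upwards [octant_ae_pos] with p hp
    exact hC' p.1 p.2.1 p.2.2 hp.1 hp.2.1 hp.2.2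
  set I : ℝ → ℝ := fun s => collision (symbol D φ) (g s) with hI
  have hcont : ContinuousOn I (Ici 0) := fun t ht =>
    tendsto_collision hH hC
      (by filter_upwards [self_mem_nhdsWithin] with s hs using hint s hs) (hint t ht)
      (hC1.tendsto_integral_abs_sub hint ht)
  have hformula : ∀ t, 0 ≤ t → (∫ x in Ioi (0 : ℝ), g t x * φ x) -
      (∫ x in Ioi (0 : ℝ), g 0 x * φ x) = CQ * ∫ s in (0 : ℝ)..t, I s := by
    intro t ht
    rw [hweak φ hφ hc t ht]
    congr 1
    refine intervalIntegral.integral_congr fun s hs => ?_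
    rw [uIcc_of_le ht] at hs
    simp only [hI]
    rw [collision_eq_iterated hH hC (hint s hs.1)]
    simp only [symbol]
    congr! 6
    ring
  have hderiv : HasDerivAt (fun t => ∫ s in (0 : ℝ)..t, I s) (I T) T := by
    refine intervalIntegral.integral_hasDerivAt_right ?_ ?_ ?_
    · refine (hcont.mono fun s hs => ?_).intervalIntegrable
      rw [uIcc_of_le hT.le] at hs
      exact hs.1
    · exact (hcont.mono Ioi_subset_Ici_self).stronglyMeasurableAtFilter isOpen_Ioi T hT
    · exact hcont.continuousAt (Ici_mem_nhds hT)
  refine IsLocalMin.hasDerivAt_eq_zero ?_ hderiv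
  filter_upwards [Ioi_mem_nhds hT] with t ht
  have h1 := hformula t (le_of_lt ht)
  have h2 := hformula T hT.le
  have h3 : 0 ≤ ∫ x in Ioi (0 : ℝ), g t x * φ x :=
    setIntegral_nonneg measurableSet_Ioi fun x hx =>
      mul_nonneg (hpos t (le_of_lt ht) x hx) (hφ0 x)
  refine le_of_mul_le_mul_left ?_ hCQ
  linarith

/-- At positive times the essential support is closed under the resonant interaction
`(a, b, c) ↦ a + b - c`. -/
lemma IsWeakSolution.add_sub_mem_support (hg : IsWeakSolution D CQ g) (hCQ : 0 < CQ)
    {T : ℝ} (hT : 0 < T) {a b c : ℝ} (ha : a ∈ (carrier (g T)).support)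
    (hb : b ∈ (carrier (g T)).support) (hc : c ∈ (carrier (g T)).support)
    (ha0 : 0 < a) (hb0 : 0 < b) (hc0 : 0 < c) (hw : 0 < a + b - c) :
    a + b - c ∈ (carrier (g T)).support := by
  by_contra hnot
  obtain ⟨V, hV, hV0⟩ := Measure.notMem_support_iff_exists.1 hnot
  obtain ⟨ε, hε, hεV⟩ := Metric.mem_nhds_iff.1 hV
  set w := a + b - c with hwdef
  set η := min ε (w / 2) with hη
  have hη0 : 0 < η := lt_min hε (half_pos hw)
  let φ : ContDiffBump w := ⟨η / 2, η, half_pos hη0, half_lt_self hη0⟩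
  have hsupp : ∀ x, φ x ≠ 0 → x ∈ Metric.ball w η := fun x hx => by
    rw [← φ.support_eq]
    exact hx
  have hvanish : ∀ x ≤ w / 2, φ x = 0 := by
    intro x hx
    by_contra h
    have h1 := hsupp x h
    rw [Metric.mem_ball, Real.dist_eq, abs_lt] at h1
    have := min_le_right ε (w / 2)
    linarith [h1.1]
  have hgφ : ∀ᵐ x ∂halfLine, g T x * φ x = 0 := by
    have h1 : (carrier (g T)) (Metric.ball w η) = 0 :=
      measure_mono_null ((Metric.ball_subset_ball (min_le_left _ _)).trans hεV) hV0
    rw [Measure.restrict_apply Metric.isOpen_ball.measurableSet] at h1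
    refine measure_mono_null (fun x hx => ?_) h1
    have hx' : g T x * φ x ≠ 0 := hx
    exact ⟨hsupp x (right_ne_zero_of_mul hx'), left_ne_zero_of_mul hx'⟩
  have hcoll := hg.collision_eq_zero hCQ (half_pos hw) φ.contDiff φ.hasCompactSupport hvanish
    (fun x => φ.nonneg) hT (integral_eq_zero_of_ae hgφ)
  have hH := aestronglyMeasurable_symbol D φ.continuous.measurable
  obtain ⟨C, hC'⟩ := exists_abs_symbol_le D (half_pos hw) φ.contDiff φ.hasCompactSupport hvanish
  have hC : ∀ᵐ p ∂octant, |symbol D φ p| ≤ C := by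
    filter_upwards [octant_ae_pos] with p hp
    exact hC' p.1 p.2.1 p.2.2 hp.1 hp.2.1 hp.2.2
  have hint := integrable_collision hH hC (hg.2.1 T hT.le)
  have e1 : ∀ᵐ p ∂octant, g T p.1 * φ p.1 = 0 := Measure.quasiMeasurePreserving_fst.ae hgφ
  have e2 : ∀ᵐ p ∂octant, g T p.2.1 * φ p.2.1 = 0 :=
    (Measure.quasiMeasurePreserving_fst.comp Measure.quasiMeasurePreserving_snd).ae hgφ
  have e3 : ∀ᵐ p ∂octant, g T p.2.2 * φ p.2.2 = 0 :=
    (Measure.quasiMeasurePreserving_snd.comp Measure.quasiMeasurePreserving_snd).ae hgφ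
  have hgain : ∀ᵐ p ∂octant, g T p.1 * (g T p.2.1 * g T p.2.2) * symbol D φ p =
      g T p.1 * (g T p.2.1 * g T p.2.2) * (kernel D p.1 p.2.1 p.2.2 *
        φ (p.1 + p.2.1 - p.2.2) * (if p.2.2 ≤ p.1 + p.2.1 then (1 : ℝ) else 0)) := by
    filter_upwards [e1, e2, e3] with p h1 h2 h3
    rw [symbol]
    set k := kernel D p.1 p.2.1 p.2.2
    set i := if p.2.2 ≤ p.1 + p.2.1 then (1 : ℝ) else 0
    linear_combination (g T p.1 * g T p.2.1 * k * i) * h3 - (g T p.2.1 * g T p.2.2 * k * i) * h1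
      - (g T p.1 * g T p.2.2 * k * i) * h2
  have hnonneg : 0 ≤ᵐ[octant] fun p => g T p.1 * (g T p.2.1 * g T p.2.2) * symbol D φ p := by
    filter_upwards [hgain, octant_ae_pos] with p hp hpp
    rw [hp, Pi.zero_apply]
    have := hg.1 T hT.le p.1 hpp.1
    have := hg.1 T hT.le p.2.1 hpp.2.1
    have := hg.1 T hT.le p.2.2 hpp.2.2
    split_ifs with hle
    · have := kernel_nonneg D hpp.1 hpp.2.1 hpp.2.2 hle
      have := φ.nonneg (x := p.1 + p.2.1 - p.2.2)
      positivity
    · simp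
  have hzero := (integral_eq_zero_iff_of_nonneg_ae hnonneg hint).1 hcoll
  set σ := min (η / 3) (min a (min b c)) with hσ
  have hσ0 : 0 < σ := lt_min (by positivity) (lt_min ha0 (lt_min hb0 hc0))
  have hball : ∀ x : ℝ, x ∈ Metric.ball x σ := fun x => Metric.mem_ball_self hσ0
  have hbox : octant ((Metric.ball a σ ∩ Function.support (g T)) ×ˢ
      ((Metric.ball b σ ∩ Function.support (g T)) ×ˢ
        (Metric.ball c σ ∩ Function.support (g T)))) ≠ 0 := by
    rw [Measure.prod_prod, Measure.prod_prod]
    exact mul_ne_zero (carrier_pos_inter ha Metric.isOpen_ball (hball a)).ne'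
      (mul_ne_zero (carrier_pos_inter hb Metric.isOpen_ball (hball b)).ne'
        (carrier_pos_inter hc Metric.isOpen_ball (hball c)).ne')
  refine hbox (measure_eq_zero_iff_ae_notMem.2 ?_)
  filter_upwards [hzero, hgain, octant_ae_pos] with p hp0 hpg hpp ⟨⟨hpa, hga⟩, ⟨hpb, hgb⟩, hpc, hgc⟩
  rw [hpg, Pi.zero_apply] at hp0
  rw [Metric.mem_ball, Real.dist_eq, abs_lt] at hpa hpb hpc
  have hση : σ ≤ η / 3 := min_le_left _ _
  have hηw : η ≤ w / 2 := min_le_right _ _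
  have hpw : p.1 + p.2.1 - p.2.2 ∈ Metric.ball w η := by
    rw [Metric.mem_ball, Real.dist_eq, abs_lt]
    constructor <;> linarith
  have hw0 : 0 < p.1 + p.2.1 - p.2.2 := by
    rw [Metric.mem_ball, Real.dist_eq, abs_lt] at hpw
    linarith [hpw.1]
  rw [if_pos (by linarith), mul_one] at hp0
  have hφpos : φ (p.1 + p.2.1 - p.2.2) ≠ 0 := (φ.pos_of_mem_ball hpw).ne'
  exact mul_ne_zero (mul_ne_zero hga (mul_ne_zero hgb hgc))
    (mul_ne_zero (kernel_pos D hpp.1 hpp.2.1 hpp.2.2 hw0).ne' hφpos) hp0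

end WeakSolution

/-- An uncountable set of reals contains distinct points at arbitrarily small distance. -/
lemma exists_lt_sub_lt_of_not_countable {S : Set ℝ} (hS : ¬ S.Countable) {ε : ℝ} (hε : 0 < ε) :
    ∃ a ∈ S, ∃ b ∈ S, a < b ∧ b - a < ε := by
  by_contra! h
  refine hS ((mapsTo_univ (fun x : ℝ => ⌊x / ε⌋) S).countable_of_injOn ?_ countable_univ)
  have key : ∀ x ∈ S, ∀ y ∈ S, ⌊x / ε⌋ = ⌊y / ε⌋ → ¬ x < y := by
    intro x hx y hy hxy hlt
    have h1 := Int.abs_sub_lt_one_of_floor_eq_floor hxy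
    rw [← sub_div, abs_div, abs_of_pos hε, div_lt_one hε, abs_lt] at h1
    linarith [h x hx y hy hlt, h1.1]
  intro x hx y hy hxy
  exact le_antisymm (not_lt.1 (key y hy x hx hxy.symm)) (not_lt.1 (key x hx y hy hxy))

/-- An uncountable set of positive reals closed under `(a, b, c) ↦ a + b - c`, as long as the
result is positive, is dense in the half-line. -/
lemma exists_mem_Ioc_of_add_sub_mem {S : Set ℝ} (hpos : ∀ x ∈ S, 0 < x) (hS : ¬ S.Countable)
    (hadd : ∀ a ∈ S, ∀ b ∈ S, ∀ c ∈ S, 0 < a + b - c → a + b - c ∈ S)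
    {w ε : ℝ} (hε : 0 < ε) (hεw : ε ≤ w) : ∃ x ∈ S, w - ε < x ∧ x ≤ w := by
  obtain ⟨a, ha, b, hb, hab, hd⟩ := exists_lt_sub_lt_of_not_countable hS hε
  set d := b - a with hd_def
  have hd0 : 0 < d := sub_pos.2 hab
  have hup : ∀ n : ℕ, a + n * d ∈ S := by
    intro n
    induction n with
    | zero => simpa using ha
    | succ n ih =>
      have hx := hpos _ ih
      have h := hadd _ ih b hb a ha (by linarith)
      convert h using 1
      push_cast
      ring
  have hdown : ∀ n : ℕ, 0 < a - n * d → a - n * d ∈ S := by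
    intro n
    induction n with
    | zero => simp [ha]
    | succ n ih =>
      intro hn
      push_cast at hn
      have e : a - (n + 1 : ℝ) * d = a - n * d + a - b := by
        rw [hd_def]
        ring
      push_cast
      rw [e] at hn ⊢
      exact hadd _ (ih (by linarith)) a ha b hb hn
  have hfl := Int.floor_le ((w - a) / d)
  have hlf := Int.lt_floor_add_one ((w - a) / d)
  rw [le_div_iff₀ hd0] at hfl
  rw [div_lt_iff₀ hd0] at hlf
  obtain ⟨n, hn | hn⟩ := Int.eq_nat_or_neg ⌊(w - a) / d⌋
  · rw [hn] at hfl hlf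
    push_cast at hfl hlf
    exact ⟨a + n * d, hup n, by linarith, by linarith⟩
  · rw [hn] at hfl hlf
    push_cast at hfl hlf
    exact ⟨a - n * d, hdown n (by linarith), by linarith, by linarith⟩

lemma not_countable_carrier_support {G : ℝ → ℝ} (hG : ¬ ∀ᵐ x ∂halfLine, G x = 0) :
    ¬ ((carrier G).support ∩ Ioi 0).Countable := by
  intro hcount
  have h1 : carrier G ((carrier G).support ∩ Ioi 0) = 0 := hcount.measure_zero _
  have h2 : carrier G ((carrier G).support)ᶜ = 0 := Measure.measure_compl_support
  have h3 : carrier G (Ioi 0)ᶜ = 0 := by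
    refine Measure.absolutelyContinuous_of_le Measure.restrict_le_self ?_
    rw [Measure.restrict_apply measurableSet_Ioi.compl, compl_inter_self, measure_empty]
  have h4 : carrier G univ = 0 := by
    refine measure_mono_null (fun x _ => ?_) (measure_union_null h1 (measure_union_null h2 h3))
    by_cases hx : x ∈ (carrier G).support <;> by_cases hx0 : x ∈ Ioi (0 : ℝ) <;> simp_all
  refine hG ?_
  rw [Measure.restrict_apply_univ] at h4
  exact h4

lemma IsWeakSolution.mem_tsupport {D : Dispersion} {CQ : ℝ} {g : ℝ → ℝ → ℝ}
    (hg : IsWeakSolution D CQ g) (hCQ : 0 < CQ) {T : ℝ} (hT : 0 < T)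
    (hne : ¬ ∀ᵐ x ∂halfLine, g T x = 0) {w : ℝ} (hw : 0 < w) : w ∈ tsupport (g T) := by
  by_contra hnot
  have hV : (tsupport (g T))ᶜ ∈ nhds w := (isClosed_tsupport _).isOpen_compl.mem_nhds hnot
  obtain ⟨ε, hε, hεV⟩ := Metric.mem_nhds_iff.1 hV
  obtain ⟨x, ⟨hx, -⟩, hx1, hx2⟩ := exists_mem_Ioc_of_add_sub_mem (fun x hx => hx.2)
    (not_countable_carrier_support hne)
    (fun a ha b hb c hc h => ⟨hg.add_sub_mem_support hCQ hT ha.1 hb.1 hc.1 ha.2 hb.2 hc.2 h, h⟩)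
    (lt_min hε hw) (min_le_right ε w)
  have hxball : x ∈ Metric.ball w ε := by
    rw [Metric.mem_ball, Real.dist_eq, abs_lt]
    constructor <;> linarith [min_le_left ε w]
  refine (carrier_pos_inter hx Metric.isOpen_ball hxball).ne' ?_
  convert measure_empty (μ := halfLine)
  refine eq_empty_of_forall_notMem fun y hy => hεV hy.1 (subset_tsupport _ hy.2)

/-- A nontrivial weak solution stays nontrivial for a short positive time. -/
lemma IsWeakSolution.exists_pos_time {D : Dispersion} {CQ : ℝ} {g : ℝ → ℝ → ℝ}
    (hg : IsWeakSolution D CQ g) (hne : ¬ ∀ᵐ x ∂halfLine, g 0 x = 0) :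
    ∃ T, 0 < T ∧ ¬ ∀ᵐ x ∂halfLine, g T x = 0 := by
  by_contra! h
  have hlim := (hg.2.2.1.tendsto_integral_abs_sub hg.2.1 le_rfl).mono_left
    (nhdsWithin_mono 0 Ioi_subset_Ici_self)
  have hconst : Tendsto (fun s => ∫ x, |g s x - g 0 x| ∂halfLine) (nhdsWithin 0 (Ioi 0))
      (nhds (∫ x, |g 0 x| ∂halfLine)) := by
    refine tendsto_const_nhds.congr' ?_
    filter_upwards [self_mem_nhdsWithin] with s hs
    refine integral_congr_ae ?_
    filter_upwards [h s hs] with x hx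
    simp [hx]
  have hzero := tendsto_nhds_unique hconst hlim
  rw [integral_eq_zero_iff_of_nonneg (fun x => abs_nonneg _) (hg.2.1 0 le_rfl).abs] at hzero
  refine hne ?_
  filter_upwards [hzero] with x hx
  simpa using hx

lemma not_ae_eq_zero_of_initial {D : Dispersion} {g₀ F₀ : ℝ → ℝ}
    {f₀ : EuclideanSpace ℝ (Fin 3) → ℝ} (hrad : ∀ k, f₀ k = F₀ ‖k‖)
    (hinit : ∀ ω, 0 < ω → g₀ ω = D.U (D.r ω) * D.r ω * F₀ (D.r ω))
    (hsupp : (interior (Function.support f₀)).Nonempty) : ¬ ∀ᵐ x ∂halfLine, g₀ x = 0 := by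
  intro hae
  obtain ⟨k, hk⟩ := hsupp
  obtain ⟨ε, hε, hball⟩ := Metric.mem_nhds_iff.1 (mem_interior_iff_mem_nhds.1 hk)
  have hF : ∀ ρ ∈ Ioo ‖k‖ (‖k‖ + ε), F₀ ρ ≠ 0 := by
    intro ρ hρ
    obtain ⟨k', hk', hdist⟩ : ∃ k' : EuclideanSpace ℝ (Fin 3), ‖k'‖ = ρ ∧ ‖k' - k‖ < ε := by
      rcases eq_or_ne k 0 with rfl | hk0
      · obtain ⟨v, hv⟩ := exists_norm_eq (EuclideanSpace ℝ (Fin 3))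
          ((norm_nonneg _).trans hρ.1.le)
        refine ⟨v, hv, ?_⟩
        have := hρ.2
        simp only [norm_zero, zero_add] at this
        rwa [sub_zero, hv]
      · have hn : 0 < ‖k‖ := norm_pos_iff.2 hk0
        refine ⟨(ρ / ‖k‖) • k, ?_, ?_⟩
        · rw [norm_smul, Real.norm_of_nonneg (div_nonneg (hn.le.trans hρ.1.le) hn.le),
            div_mul_cancel₀ _ hn.ne']
        · rw [show (ρ / ‖k‖) • k - k = (ρ / ‖k‖ - 1) • k by rw [sub_smul, one_smul], norm_smul,
            Real.norm_of_nonneg (sub_nonneg.2 ((one_le_div hn).2 hρ.1.le)), sub_mul,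
            div_mul_cancel₀ _ hn.ne', one_mul]
          linarith [hρ.2]
    have h := hball (mem_ball_iff_norm.2 hdist)
    rwa [Function.mem_support, hrad, hk'] at h
  have hp : 0 ≤ ‖k‖ := norm_nonneg k
  have hlt : D.Ω ‖k‖ < D.Ω (‖k‖ + ε) :=
    D.Ω_strictMono hp (show (0 : ℝ) ≤ ‖k‖ + ε by positivity) (by linarith)
  have hvol : halfLine (Ioo (D.Ω ‖k‖) (D.Ω (‖k‖ + ε))) ≠ 0 := by
    rw [Measure.restrict_apply measurableSet_Ioo, inter_eq_left.2, Real.volume_Ioo]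
    · simpa using hlt
    · exact fun x hx => (D.Ω_nonneg hp).trans_lt hx.1
  refine hvol (measure_eq_zero_iff_ae_notMem.2 ?_)
  filter_upwards [hae] with x hx hxI
  have hx0 : 0 < x := (D.Ω_nonneg hp).trans_lt hxI.1
  have hr := D.r_pos hx0
  have hrI : D.r x ∈ Ioo ‖k‖ (‖k‖ + ε) := by
    have h1 := D.r_right x hx0.le
    constructor
    · exact (D.Ω_strictMono.lt_iff_lt hp hr.le).1 (by rw [h1]; exact hxI.1)
    · exact (D.Ω_strictMono.lt_iff_lt hr.le (show (0 : ℝ) ≤ ‖k‖ + ε by positivity)).1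
        (by rw [h1]; exact hxI.2)
  rw [hinit x hx0] at hx
  exact mul_ne_zero (mul_ne_zero (D.U_pos hr).ne' hr.ne') (hF _ hrI) hx

/-- Under the dispersion assumptions, if `g` is a global weak
solution of the reduced 4-wave kinetic equation whose initial datum is the reduced
density of a nonnegative radial `f₀` satisfying: (I) `Ω(ρ) = ρ²` and the support of
`f₀` has non-empty interior, or (II) the origin belongs to the interior of the
support of `f₀`, then every frequency `ω* > 0` eventually belongs to the support of
the solution: there is a time `T₀ > 0` with `ω* ∈ supp g(T₀,·)`. -/
theorem support_spreading
    (D : Dispersion) (CQ : ℝ) (hCQ : 0 < CQ)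
    (g : ℝ → ℝ → ℝ) (hg : IsWeakSolution D CQ g)
    (F₀ : ℝ → ℝ) (f₀ : EuclideanSpace ℝ (Fin 3) → ℝ)
    (hrad : ∀ k, f₀ k = F₀ ‖k‖) (hnonneg : ∀ k, 0 ≤ f₀ k)
    (hinit : ∀ ω, 0 < ω → g 0 ω = D.U (D.r ω) * D.r ω * F₀ (D.r ω))
    (hsupp : ((∀ ρ, 0 ≤ ρ → D.Ω ρ = ρ ^ 2) ∧ (interior (Function.support f₀)).Nonempty) ∨
      0 ∈ interior (Function.support f₀)) :
    ∀ ωstar : ℝ, 0 < ωstar → ∃ T₀ : ℝ, 0 < T₀ ∧ ωstar ∈ tsupport (g T₀) := by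
  have hne := not_ae_eq_zero_of_initial hrad hinit
    (hsupp.elim (fun h => h.2) fun h => ⟨0, h⟩)
  obtain ⟨T, hT, hneT⟩ := hg.exists_pos_time hne
  exact fun ωstar hω => ⟨T, hT, hg.mem_tsupport hCQ hT hneT hω⟩
end

section
/- Let φ : [0,∞) → ℝ be convex and let ℧ : [0,∞) → [0,∞) be nondecreasing. Then for all reals 0 ≤ a ≤ b ≤ c: [φ(b) + φ(c + a − b) − φ(a) − φ(c)] · ℧(c + a − b) + [φ(a) + φ(c + b − a) − φ(b) − φ(c)] · ℧(c + b − a) ≥ 0. (Note c + a − b ≥ a ≥ 0 since c ≥ b.) -/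
/-- A convex function has a larger sum over the endpoints of an interval than over any two points
of the interval with the same midpoint. -/
theorem ConvexOn.add_le_add_of_add_eq {s : Set ℝ} {f : ℝ → ℝ} (hf : ConvexOn ℝ s f)
    {x y u v : ℝ} (hx : x ∈ s) (hy : y ∈ s) (hxu : x ≤ u) (huy : u ≤ y) (h : u + v = x + y) :
    f u + f v ≤ f x + f y := by
  obtain ⟨p, q, hp, hq, hpq, rfl⟩ : u ∈ segment ℝ x y := by
    rw [segment_eq_Icc (hxu.trans huy)]
    exact ⟨hxu, huy⟩
  obtain rfl : v = q • x + p • y := by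
    simp only [smul_eq_mul] at h ⊢
    linear_combination h - (x + y) * hpq
  have h₁ := hf.2 hx hy hp hq hpq
  have h₂ := hf.2 hx hy hq hp (by linarith)
  calc f (p • x + q • y) + f (q • x + p • y)
      ≤ (p • f x + q • f y) + (q • f x + p • f y) := add_le_add h₁ h₂
    _ = f x + f y := by
      simp only [smul_eq_mul]
      linear_combination (f x + f y) * hpq

/-- If `φ` is convex on `[0,∞)` and `℧` (denoted `U`) is a
nondecreasing nonnegative function on `[0,∞)`, then for all `0 ≤ a ≤ b ≤ c`:
`[φ(b) + φ(c+a−b) − φ(a) − φ(c)]·℧(c+a−b) + [φ(a) + φ(c+b−a) − φ(b) − φ(c)]·℧(c+b−a) ≥ 0`. -/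
theorem convex_weighted_monotonicity_inequality (φ U : ℝ → ℝ)
    (hφ : ConvexOn ℝ (Set.Ici 0) φ)
    (hU : MonotoneOn U (Set.Ici 0)) (hU0 : ∀ x, 0 ≤ x → 0 ≤ U x)
    (a b c : ℝ) (ha : 0 ≤ a) (hab : a ≤ b) (hbc : b ≤ c) :
    0 ≤ (φ b + φ (c + a - b) - φ a - φ c) * U (c + a - b) +
        (φ a + φ (c + b - a) - φ b - φ c) * U (c + b - a) := by
  have hlo : 0 ≤ c + a - b := by linarith
  have hhi : 0 ≤ c + b - a := by linarith
  have hQ : φ b + φ c ≤ φ a + φ (c + b - a) :=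
    hφ.add_le_add_of_add_eq ha hhi hab (by linarith) (by ring)
  have hsum : φ c + φ c ≤ φ (c + a - b) + φ (c + b - a) :=
    hφ.add_le_add_of_add_eq hlo hhi (by linarith) (by linarith) (by ring)
  have hmono : U (c + a - b) ≤ U (c + b - a) := hU hlo hhi (by linarith)
  have h₁ : 0 ≤ (φ (c + a - b) + φ (c + b - a) - (φ c + φ c)) * U (c + a - b) :=
    mul_nonneg (sub_nonneg.2 hsum) (hU0 _ hlo)
  have h₂ : 0 ≤ (φ a + φ (c + b - a) - (φ b + φ c)) * (U (c + b - a) - U (c + a - b)) :=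
    mul_nonneg (sub_nonneg.2 hQ) (sub_nonneg.2 hmono)
  linear_combination h₁ + h₂
end

section
/- Let C > 0, let φ ∈ C²([0,∞)) satisfy φ''(x) ≤ −C for all x ≥ 0, and let ℧ : [0,∞) → [0,∞) be nondecreasing. Then for all reals 0 ≤ a ≤ b ≤ c: [φ(b) + φ(c + a − b) − φ(a) − φ(c)] · ℧(c + a − b) + [φ(a) + φ(c + b − a) − φ(b) − φ(c)] · ℧(c + b − a) ≤ −C (b − a)² ℧(c + b − a). -/
/-- The increments of a concave function over steps of a fixed length are nonincreasing. -/
theorem ConcaveOn.add_sub_le_add_sub {s : Set ℝ} {g : ℝ → ℝ} (hg : ConcaveOn ℝ s g)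
    {x y h : ℝ} (hx : x ∈ s) (hyh : y + h ∈ s) (hxy : x ≤ y) (hh : 0 ≤ h) :
    g (y + h) - g y ≤ g (x + h) - g x := by
  rcases hh.eq_or_lt with rfl | hh
  · simp
  have hd : 0 < y - x + h := by linarith
  have hp : 0 ≤ (y - x) / (y - x + h) := div_nonneg (by linarith) hd.le
  have hq : 0 ≤ h / (y - x + h) := div_nonneg hh.le hd.le
  have hpq : (y - x) / (y - x + h) + h / (y - x + h) = 1 := by field_simp
  have h₁ := hg.2 hx hyh hp hq hpq
  have h₂ := hg.2 hx hyh hq hp (by rw [add_comm]; exact hpq)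
  have e₁ : (y - x) / (y - x + h) * x + h / (y - x + h) * (y + h) = x + h := by
    field_simp
    ring
  have e₂ : h / (y - x + h) * x + (y - x) / (y - x + h) * (y + h) = y := by
    field_simp
    ring
  simp only [smul_eq_mul] at h₁ h₂
  rw [e₁] at h₁
  rw [e₂] at h₂
  linear_combination h₁ + h₂ - (g x + g (y + h)) * hpq

/-- If `φ'' ≤ -C` on `[0,∞)`, then `φ + C x² / 2` is concave there. -/
theorem concaveOn_add_mul_sq_of_derivWithin2_le {C : ℝ} {φ : ℝ → ℝ}
    (hφ : ContDiffOn ℝ 2 φ (Set.Ici 0))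
    (hφ'' : ∀ x, 0 ≤ x → derivWithin (derivWithin φ (Set.Ici 0)) (Set.Ici 0) x ≤ -C) :
    ConcaveOn ℝ (Set.Ici 0) fun x ↦ φ x + C / 2 * x ^ 2 := by
  have hφ' : ContDiffOn ℝ 1 (derivWithin φ (Set.Ici 0)) (Set.Ici 0) :=
    hφ.derivWithin (uniqueDiffOn_Ici 0) (by norm_num)
  refine concaveOn_of_hasDerivWithinAt2_nonpos (convex_Ici 0)
    (f' := fun x ↦ derivWithin φ (Set.Ici 0) x + C * x)
    (f'' := fun x ↦ derivWithin (derivWithin φ (Set.Ici 0)) (Set.Ici 0) x + C)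
    (hφ.continuousOn.add (by fun_prop)) ?_ ?_ ?_
  · intro x hx
    have h₁ := ((hφ.differentiableOn (by norm_num)) x (interior_subset hx)).hasDerivWithinAt
    have h₂ := ((hasDerivAt_pow 2 x).const_mul (C / 2)).hasDerivWithinAt (s := Set.Ici 0)
    refine ((h₁.add h₂).mono interior_subset).congr_deriv ?_
    norm_num
    ring
  · intro x hx
    have h₁ := ((hφ'.differentiableOn (by norm_num)) x (interior_subset hx)).hasDerivWithinAt
    have h₂ := ((hasDerivAt_id x).const_mul C).hasDerivWithinAt (s := Set.Ici 0)
    exact ((h₁.add h₂).mono interior_subset).congr_deriv (by simp)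
  · intro x hx
    linarith [hφ'' x (interior_subset hx)]

/-- If `φ ∈ C²([0,∞))` has second derivative bounded above by
`−C < 0` on `[0,∞)` and `℧` (denoted `U`) is nondecreasing and nonnegative on
`[0,∞)`, then for all `0 ≤ a ≤ b ≤ c`:
`[φ(b) + φ(c+a−b) − φ(a) − φ(c)]·℧(c+a−b) + [φ(a) + φ(c+b−a) − φ(b) − φ(c)]·℧(c+b−a)
  ≤ −C (b−a)² ℧(c+b−a)`. -/
theorem concave_quantitative_inequality (C : ℝ) (hC : 0 < C) (φ U : ℝ → ℝ)
    (hφ : ContDiffOn ℝ 2 φ (Set.Ici 0))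
    (hφ'' : ∀ x, 0 ≤ x → derivWithin (derivWithin φ (Set.Ici 0)) (Set.Ici 0) x ≤ -C)
    (hU : MonotoneOn U (Set.Ici 0)) (hU0 : ∀ x, 0 ≤ x → 0 ≤ U x)
    (a b c : ℝ) (ha : 0 ≤ a) (hab : a ≤ b) (hbc : b ≤ c) :
    (φ b + φ (c + a - b) - φ a - φ c) * U (c + a - b) +
        (φ a + φ (c + b - a) - φ b - φ c) * U (c + b - a) ≤
      -C * (b - a) ^ 2 * U (c + b - a) := by
  have hg := concaveOn_add_mul_sq_of_derivWithin2_le hφ hφ''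
  have hlow : 0 ≤ c + a - b := by linarith
  have h₁ := hg.add_sub_le_add_sub (x := a) (y := c + a - b) (h := b - a) ha
    (Set.mem_Ici.2 (by linarith)) (by linarith) (by linarith)
  have h₂ := hg.add_sub_le_add_sub (x := c + a - b) (y := c) (h := b - a) hlow
    (Set.mem_Ici.2 (by linarith)) (by linarith) (by linarith)
  have e₁ : c + a - b + (b - a) = c := by ring
  have e₂ : a + (b - a) = b := by ring
  have e₃ : c + (b - a) = c + b - a := by ring
  simp only [e₁, e₂, e₃] at h₁ h₂
  have hprod : 0 ≤ C * ((b - a) * (c - b)) :=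
    mul_nonneg hC.le (mul_nonneg (by linarith) (by linarith))
  have hfirst : 0 ≤ φ b + φ (c + a - b) - φ a - φ c := by
    linear_combination h₁ + hprod
  have hsum : φ (c + a - b) + φ (c + b - a) - 2 * φ c ≤ -C * (b - a) ^ 2 := by
    linear_combination h₂
  have hUmono : U (c + a - b) ≤ U (c + b - a) :=
    hU hlow (Set.mem_Ici.2 (by linarith)) (by linarith)
  have hUnonneg : 0 ≤ U (c + b - a) := hU0 _ (by linarith)
  linear_combination mul_le_mul_of_nonneg_left hUmono hfirst +
    mul_le_mul_of_nonneg_right hsum hUnonneg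
end

section
/- Let k₀ ∈ ℝ³, R > 0 and 0 < r ≤ R/1000. Define T := { k₁ + k₂ − k₃ : k₁, k₂, k₃ ∈ B(k₀, R), |k₁ + k₂ − k₃|² = |k₁|² + |k₂|² − |k₃|² }, the one-step collision set of the closed ball B(k₀, R) for the dispersion ω(k) = |k|². Then B(k₀, 𝓡(r,R)) ⊆ T ∪ {0}, where 𝓡(r,R) := √(R² − 45r²) + 3√2 r (which is strictly larger than R). -/
/-- The one-step collision set of a set `S ⊆ ℝ³` for the dispersion `ω(k) = |k|²`:
all `k₁ + k₂ − k₃` with `k₁, k₂, k₃ ∈ S` satisfying the resonance condition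
`|k₁ + k₂ − k₃|² = |k₁|² + |k₂|² − |k₃|²`. -/
def oneStepCollision (S : Set (EuclideanSpace ℝ (Fin 3))) :
    Set (EuclideanSpace ℝ (Fin 3)) :=
  {k | ∃ k₁ ∈ S, ∃ k₂ ∈ S, ∃ k₃ ∈ S,
    k = k₁ + k₂ - k₃ ∧ ‖k‖ ^ 2 = ‖k₁‖ ^ 2 + ‖k₂‖ ^ 2 - ‖k₃‖ ^ 2}

open scoped RealInnerProductSpace in
/-- In a real inner product space of dimension at least two, every vector has an orthogonal
vector of the same norm. -/
theorem exists_inner_eq_zero_norm_eq {E : Type*} [NormedAddCommGroup E] [InnerProductSpace ℝ E]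
    [FiniteDimensional ℝ E] (hE : 1 < Module.finrank ℝ E) (u : E) :
    ∃ w : E, ⟪u, w⟫ = 0 ∧ ‖w‖ = ‖u‖ := by
  have hsum := Submodule.finrank_add_finrank_orthogonal (ℝ ∙ u)
  have hspan : Module.finrank ℝ (ℝ ∙ u) ≤ 1 := by
    simpa using finrank_span_le_card (R := ℝ) ({u} : Set E)
  have : Nontrivial (ℝ ∙ u)ᗮ := Module.nontrivial_of_finrank_pos (R := ℝ) (by omega)
  obtain ⟨w, hw⟩ := exists_norm_eq (ℝ ∙ u)ᗮ (norm_nonneg u)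
  exact ⟨w, Submodule.mem_orthogonal_singleton_iff_inner_right.mp w.2, hw⟩

/-- The one-step collision set of a ball of radius `R` contains the concentric ball of
radius `√2 R`. -/
theorem mem_oneStepCollision_closedBall (k₀ k : EuclideanSpace ℝ (Fin 3)) {R : ℝ} (hR : 0 ≤ R)
    (hk : ‖k - k₀‖ ^ 2 ≤ 2 * R ^ 2) : k ∈ oneStepCollision (Metric.closedBall k₀ R) := by
  obtain ⟨u, rfl⟩ : ∃ u, k = k₀ + u := ⟨k - k₀, by abel⟩
  rw [add_sub_cancel_left] at hk
  obtain ⟨w, huw, hw⟩ := exists_inner_eq_zero_norm_eq (by simp) u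
  have hadd : ‖u + w‖ ^ 2 = 2 * ‖u‖ ^ 2 := by
    rw [norm_add_sq_real, huw, hw]; ring
  have hsub : ‖u - w‖ ^ 2 = 2 * ‖u‖ ^ 2 := by
    rw [norm_sub_sq_real, huw, hw]; ring
  refine ⟨k₀ + (1 / 2 : ℝ) • (u + w), ?_, k₀ + (1 / 2 : ℝ) • (u - w), ?_, k₀,
    Metric.mem_closedBall_self hR, by module, ?_⟩
  · rw [mem_closedBall_iff_norm, add_sub_cancel_left]
    rw [← sq_le_sq₀ (norm_nonneg _) hR]
    rw [norm_smul, mul_pow, hadd]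
    norm_num
    linarith
  · rw [mem_closedBall_iff_norm, add_sub_cancel_left]
    rw [← sq_le_sq₀ (norm_nonneg _) hR]
    rw [norm_smul, mul_pow, hsub]
    norm_num
    linarith
  · simp only [norm_add_sq_real k₀, norm_smul, mul_pow, hadd, hsub, inner_smul_right,
      inner_add_right, inner_sub_right]
    norm_num
    ring

/-- For `0 < r ≤ R/1000`, the one-step collision set `T` of the
closed ball `B(k₀,R)` (for `ω(k) = |k|²`) together with the origin contains the
strictly larger ball `B(k₀, 𝓡(r,R))` with `𝓡(r,R) = √(R² − 45r²) + 3√2·r > R`. -/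
theorem ball_growth_one_step (k₀ : EuclideanSpace ℝ (Fin 3)) (R r : ℝ)
    (hR : 0 < R) (hr : 0 < r) (hrR : r ≤ R / 1000) :
    R < Real.sqrt (R ^ 2 - 45 * r ^ 2) + 3 * Real.sqrt 2 * r ∧
    Metric.closedBall k₀ (Real.sqrt (R ^ 2 - 45 * r ^ 2) + 3 * Real.sqrt 2 * r) ⊆
      oneStepCollision (Metric.closedBall k₀ R) ∪ {0} := by
  have h2 : Real.sqrt 2 ^ 2 = 2 := Real.sq_sqrt (by norm_num)
  have hlow : 1.4 < Real.sqrt 2 := Real.lt_sqrt_of_sq_lt (by norm_num)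
  have hupp : Real.sqrt 2 < 1.5 := (Real.sqrt_lt' (by norm_num)).mpr (by norm_num)
  constructor
  · have hsqrt : R - 3 * Real.sqrt 2 * r < Real.sqrt (R ^ 2 - 45 * r ^ 2) := by
      apply Real.lt_sqrt_of_sq_lt
      have hrR' : r * r ≤ r * (R / 1000) := mul_le_mul_of_nonneg_left hrR hr.le
      have hlow' : 1.4 * (r * R) < Real.sqrt 2 * (r * R) :=
        mul_lt_mul_of_pos_right hlow (mul_pos hr hR)
      have hexp : (R - 3 * Real.sqrt 2 * r) ^ 2
          = R ^ 2 - 6 * (Real.sqrt 2 * (r * R)) + 18 * r ^ 2 := by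
        linear_combination 9 * r ^ 2 * h2
      nlinarith [mul_pos hr hR]
    linarith
  · intro k hk
    left
    rw [mem_closedBall_iff_norm] at hk
    have hsqrt : Real.sqrt (R ^ 2 - 45 * r ^ 2) ≤ R :=
      (Real.sqrt_le_left hR.le).mpr (by nlinarith)
    have hle : ‖k - k₀‖ ≤ 1.1 * R := by nlinarith
    apply mem_oneStepCollision_closedBall k₀ k hR.le
    nlinarith [norm_nonneg (k - k₀)]
end
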